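/- arXiv:2405.13909 — 2 statements merged into one kernel-verified Lean document; each statement's English description precedes it below -/
import Mathlib

section
/- Let T be a map sending each smooth function Ψ : ℝ^(1+d) → ℝ to a smooth function T[Ψ] : ℝ^(1+d) → ℝ. Assume: (C) Causality: for all smooth Ψ, Ψ̄ and every point p, if there exists ε > 0 such that Ψ = Ψ̄ on the truncated backward cone J⁻_ε(p), then T[Ψ](p) = T[Ψ̄](p). (G) Differentiability along segments: there is a map ∂T assigning to each smooth Ψ a linear map Φ ↦ ∂T[Ψ](Φ) from smooth functions to smooth functions such that for all smooth Ψ, Ψ̄ and every p, the function s ↦ T[(1−s)Ψ + sΨ̄](p) is differentiable on [0,1] with continuous derivative equal to ∂T[(1−s)Ψ + sΨ̄](Ψ̄ − Ψ)(p), and moreover ∂T[Ψ](Φ)(p) = lim_{h→0} (T[Ψ + hΦ](p) − T[Ψ](p))/h for all smooth Ψ, Φ and all p. (B) Boundedness: for every compactly supported smooth Φ and every compact set K ⊆ ℝ^(1+d), sup over all smooth Ψ and all p ∈ K of |∂T[Ψ](Φ)(p)| is finite. (T) Translation equivariance: for every a ∈ ℝ^(1+d) and smooth Ψ, T[Ψ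 ∘ τ_a] = T[Ψ] ∘ τ_a, where τ_a(x) = x + a. Then there exists a natural number M such that for every point p and all smooth Ψ, Ψ̄, if the iterated derivatives of Ψ and Ψ̄ of all orders j ≤ M coincide at p, then T[Ψ](p) = T[Ψ̄](p). -/
open Filter Topology

/-- The truncated backward light-cone with apex `p` and time depth `ε`,
in flat space-time `ℝ^(1+d)` with points written `(x₀, x⃗)`. -/
def backwardCone {d : ℕ} (p : ℝ × EuclideanSpace ℝ (Fin d)) (ε : ℝ) :
    Set (ℝ × EuclideanSpace ℝ (Fin d)) :=
  {x | ‖x.2 - p.2‖ ≤ p.1 - x.1 ∧ p.1 - ε ≤ x.1 ∧ x.1 ≤ p.1}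

theorem exists_norm_iteratedFDeriv_le_pow_of_jet_eq_zero {E F : Type}
    [NormedAddCommGroup E] [NormedSpace ℝ E] [FiniteDimensional ℝ E]
    [NormedAddCommGroup F] [NormedSpace ℝ F] (n : ℕ) (f : E → F)
    (hf : ContDiff ℝ (⊤ : ℕ∞) f) (h0 : ∀ j < n, iteratedFDeriv ℝ j f 0 = 0) :
    ∃ C, 0 ≤ C ∧ ∀ x, ‖x‖ ≤ 1 → ∀ j ≤ n, ‖iteratedFDeriv ℝ j f x‖ ≤ C * ‖x‖ ^ (n - j) := by
  induction n generalizing F with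
  | zero =>
    obtain ⟨C, hC⟩ := (isCompact_closedBall (0 : E) 1).exists_bound_of_continuousOn
      hf.continuous.continuousOn
    refine ⟨C, (norm_nonneg _).trans (hC 0 (by simp)), fun x hx j hj => ?_⟩
    obtain rfl : j = 0 := by omega
    simpa using hC x (by simpa using hx)
  | succ n ih =>
    have hf' : ContDiff ℝ (⊤ : ℕ∞) (fderiv ℝ f) := hf.fderiv_right (by simp)
    obtain ⟨C, hC0, hC⟩ := ih (fderiv ℝ f) hf' fun j hj => by
      rw [← norm_eq_zero, norm_iteratedFDeriv_fderiv, h0 (j + 1) (by omega), norm_zero]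
    refine ⟨C, hC0, fun x hx j hj => ?_⟩
    rcases j with _ | j
    · have hf0 : f 0 = 0 := by
        have := congrArg norm (h0 0 (by omega))
        simpa using this
      have hbound : ∀ y ∈ Metric.closedBall (0 : E) ‖x‖, ‖fderiv ℝ f y‖ ≤ C * ‖x‖ ^ n := by
        intro y hy
        have hy' : ‖y‖ ≤ ‖x‖ := by simpa using hy
        have := hC y (hy'.trans hx) 0 (by omega)
        rw [norm_iteratedFDeriv_zero, Nat.sub_zero] at this
        exact this.trans (by gcongr)
      have := (convex_closedBall (0 : E) ‖x‖).norm_image_sub_le_of_norm_fderiv_le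
        (fun y _ => (hf.differentiable (by simp)).differentiableAt) hbound
        (x := 0) (y := x) (by simp) (by simp)
      simpa [hf0, pow_succ, mul_assoc] using this
    · rw [← norm_iteratedFDeriv_fderiv, Nat.add_sub_add_right]
      exact hC x hx j (by omega)

theorem ContDiffBump.exists_norm_iteratedFDeriv_le {E : Type*} [NormedAddCommGroup E]
    [NormedSpace ℝ E] [FiniteDimensional ℝ E] {c : E} (χ : ContDiffBump c) (M : ℕ) :
    ∃ B, 0 ≤ B ∧ ∀ i ≤ M, ∀ x, ‖iteratedFDeriv ℝ i χ x‖ ≤ B := by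
  have hb : ∀ i : ℕ, ∃ B, ∀ x, ‖iteratedFDeriv ℝ i χ x‖ ≤ B := fun i =>
    (χ.hasCompactSupport.iteratedFDeriv i).exists_bound_of_continuous
      ((χ.contDiff (n := (⊤ : ℕ∞))).continuous_iteratedFDeriv (by exact_mod_cast le_top))
  choose b hb using hb
  have hb0 : ∀ i, 0 ≤ b i := fun i => (norm_nonneg _).trans (hb i c)
  refine ⟨∑ i ∈ Finset.range (M + 1), b i, Finset.sum_nonneg fun i _ => hb0 i, fun i hi x => ?_⟩
  exact (hb i x).trans (Finset.single_le_sum (fun i _ => hb0 i) (by simp; omega))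

/-- A smooth function whose jet of order `M` vanishes at the origin agrees near the origin with
smooth functions of arbitrarily small support and arbitrarily small derivatives of order `≤ M`. -/
theorem exists_localization_of_jet_eq_zero {E : Type} [NormedAddCommGroup E] [NormedSpace ℝ E]
    [FiniteDimensional ℝ E] (M : ℕ) (f : E → ℝ)
    (hf : ContDiff ℝ (⊤ : ℕ∞) f) (h0 : ∀ j ≤ M, iteratedFDeriv ℝ j f 0 = 0)
    {r η : ℝ} (hr : 0 < r) (hη : 0 < η) :
    ∃ g : E → ℝ, ContDiff ℝ (⊤ : ℕ∞) g ∧ g =ᶠ[𝓝 0] f ∧ (∀ x, r ≤ ‖x‖ → g x = 0) ∧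
      ∀ j ≤ M, ∀ x, ‖iteratedFDeriv ℝ j g x‖ ≤ η := by
  obtain ⟨C, hC0, hC⟩ := exists_norm_iteratedFDeriv_le_pow_of_jet_eq_zero (M + 1) f hf
    fun j hj => h0 j (by omega)
  let χ : ContDiffBump (0 : E) := ⟨1 / 2, 1, by norm_num, by norm_num⟩
  have hχ : ContDiff ℝ (⊤ : ℕ∞) χ := χ.contDiff
  obtain ⟨B, hB0, hB⟩ := χ.exists_norm_iteratedFDeriv_le M
  obtain ⟨δ, hδ0, hδ⟩ : ∃ δ > 0, δ ≤ 1 ∧ δ ≤ r ∧ 2 ^ M * (B * C) * δ ≤ η := by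
    have hK : 0 < 2 ^ M * (B * C) + 1 := by positivity
    refine ⟨min (min 1 r) (η / (2 ^ M * (B * C) + 1)), by positivity,
      (min_le_left _ _).trans (min_le_left _ _), (min_le_left _ _).trans (min_le_right _ _), ?_⟩
    calc 2 ^ M * (B * C) * min (min 1 r) (η / (2 ^ M * (B * C) + 1))
        ≤ (2 ^ M * (B * C) + 1) * (η / (2 ^ M * (B * C) + 1)) := by
          gcongr
          · linarith
          · exact min_le_right _ _
      _ = η := by field_simp
  obtain ⟨hδ1, hδr, hδη⟩ := hδ
  have hscale : ContDiff ℝ (⊤ : ℕ∞) fun x : E => χ (δ⁻¹ • x) :=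
    hχ.comp (contDiff_id.const_smul δ⁻¹)
  refine ⟨fun x => χ (δ⁻¹ • x) * f x, hscale.mul hf, ?_, fun x hx => ?_, fun m hm x => ?_⟩
  · have ht : Tendsto (fun x : E => δ⁻¹ • x) (𝓝 0) (𝓝 0) := by
      simpa using (continuous_const_smul (δ⁻¹ : ℝ) (T := E)).tendsto 0
    filter_upwards [ht.eventually χ.eventuallyEq_one] with x hx
    simp [hx]
  · have : χ (δ⁻¹ • x) = 0 := χ.zero_of_le_dist (by
      rw [dist_zero_right, norm_smul, norm_inv, Real.norm_of_nonneg hδ0.le]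
      change 1 ≤ δ⁻¹ * ‖x‖
      rw [le_inv_mul_iff₀ hδ0]
      linarith)
    simp [this]
  · have hterm : ∀ i ∈ Finset.range (m + 1),
        (m.choose i : ℝ) * ‖iteratedFDeriv ℝ i (fun x : E => χ (δ⁻¹ • x)) x‖ *
          ‖iteratedFDeriv ℝ (m - i) f x‖ ≤ m.choose i * ((B * C) * δ) := by
      intro i hi
      have him : i ≤ m := by simpa [Nat.lt_succ_iff] using hi
      rw [mul_assoc]
      refine mul_le_mul_of_nonneg_left ?_ (by positivity)
      rw [iteratedFDeriv_comp_const_smul _ (hχ.of_le (by exact_mod_cast le_top)), norm_smul]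
      by_cases hx : ‖x‖ ≤ δ
      · have h1 := hB i (him.trans hm) (δ⁻¹ • x)
        have h2 := hC x (hx.trans hδ1) (m - i) (by omega)
        have h3 : ‖x‖ ^ (M + 1 - (m - i)) ≤ δ ^ (i + 1) :=
          (pow_le_pow_left₀ (norm_nonneg _) hx _).trans
            (pow_le_pow_of_le_one hδ0.le hδ1 (by omega))
        calc ‖δ⁻¹ ^ i‖ * ‖iteratedFDeriv ℝ i χ (δ⁻¹ • x)‖ * ‖iteratedFDeriv ℝ (m - i) f x‖
            ≤ ‖δ⁻¹ ^ i‖ * B * (C * δ ^ (i + 1)) := by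
              gcongr
              exact h2.trans (by gcongr)
          _ = (B * C) * δ := by
              rw [norm_pow, norm_inv, Real.norm_of_nonneg hδ0.le]
              rw [inv_pow, pow_succ]
              field_simp
      · have : iteratedFDeriv ℝ i χ (δ⁻¹ • x) = 0 := by
          refine image_eq_zero_of_notMem_tsupport fun hmem => hx ?_
          have := tsupport_iteratedFDeriv_subset i hmem
          rw [χ.tsupport_eq, mem_closedBall_zero_iff, norm_smul, norm_inv,
            Real.norm_of_nonneg hδ0.le] at this
          change δ⁻¹ * ‖x‖ ≤ 1 at this
          rw [inv_mul_le_iff₀ hδ0] at this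
          linarith
        rw [this]
        simp only [norm_zero, mul_zero, zero_mul]
        positivity
    calc _ ≤ _ := norm_iteratedFDeriv_mul_le hscale hf x (n := m) (by exact_mod_cast le_top)
      _ ≤ ∑ i ∈ Finset.range (m + 1), (m.choose i : ℝ) * ((B * C) * δ) :=
          Finset.sum_le_sum hterm
      _ = 2 ^ m * (B * C) * δ := by
          rw [← Finset.sum_mul, ← Nat.cast_sum, Nat.sum_range_choose]
          push_cast
          ring
      _ ≤ 2 ^ M * (B * C) * δ := by
          gcongr
          norm_num
      _ ≤ η := hδη

/-- Smooth functions `f k` whose jets of order `k` vanish at the origin can be realized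
simultaneously, as germs at points of a fixed compact set, by one test function. -/
theorem exists_testFunction_of_jets_eq_zero {V : Type} [NormedAddCommGroup V] [NormedSpace ℝ V]
    [FiniteDimensional ℝ V] (f : ℕ → ℝ × V → ℝ) (hf : ∀ k, ContDiff ℝ (⊤ : ℕ∞) (f k))
    (h0 : ∀ k, ∀ j ≤ k, iteratedFDeriv ℝ j (f k) 0 = 0) :
    ∃ (Φ : ℝ × V → ℝ) (p : ℕ → ℝ × V), ContDiff ℝ (⊤ : ℕ∞) Φ ∧ HasCompactSupport Φ ∧
      (∀ k, ‖p k‖ ≤ 1) ∧ ∀ k, (fun x => Φ (x + p k)) =ᶠ[𝓝 0] f k := by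
  have hpos : ∀ k : ℕ, (0 : ℝ) < (1 / 2) ^ k := fun k => by positivity
  have hle1 : ∀ k : ℕ, ((1 : ℝ) / 2) ^ k ≤ 1 := fun k => pow_le_one₀ (by norm_num) (by norm_num)
  choose g hg hgf hg0 hgb using fun k => exists_localization_of_jet_eq_zero k (f k) (hf k) (h0 k)
    (r := (1 / 2) ^ k / 4) (η := (1 / 2) ^ k) (by positivity) (hpos k)
  let p : ℕ → ℝ × V := fun k => ((1 / 2) ^ k, 0)
  have hp : ∀ k, ‖p k‖ ≤ 1 := fun k => by
    simp only [p, Prod.norm_mk, norm_zero, Real.norm_of_nonneg (hpos k).le]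
    exact max_le (hle1 k) zero_le_one
  have hsep : ∀ k l : ℕ, k < l → ∀ x, ‖x - p k‖ < (1 / 2) ^ k / 4 →
      ‖x - p l‖ < (1 / 2) ^ l / 4 → False := by
    intro k l hkl x hk hl
    have hk' := (norm_fst_le (x - p k)).trans_lt hk
    have hl' := (norm_fst_le (x - p l)).trans_lt hl
    have hlk : ((1 : ℝ) / 2) ^ l ≤ (1 / 2) ^ (k + 1) :=
      pow_le_pow_of_le_one (by norm_num) (by norm_num) hkl
    rw [pow_succ] at hlk
    simp only [p, Prod.fst_sub, Real.norm_eq_abs, abs_lt] at hk' hl'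
    linarith [hk'.1, hl'.2, hpos k]
  have hdisj : ∀ k l : ℕ, l ≠ k → ∀ x, ‖x - p k‖ < (1 / 2) ^ k / 4 → g l (x - p l) = 0 := by
    intro k l hlk x hx
    refine hg0 l _ (not_lt.1 fun hlt => ?_)
    rcases hlk.lt_or_gt with h | h
    · exact hsep l k h x hlt hx
    · exact hsep k l h x hx hlt
  refine ⟨fun x => ∑' k, g k (x - p k), p, ?_, ?_, hp, fun k => ?_⟩
  · refine contDiff_tsum_of_eventually (v := fun _ k => (1 / 2 : ℝ) ^ k)
      (fun k => (hg k).comp (contDiff_id.sub contDiff_const))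
      (fun _ _ => summable_geometric_two) fun m _ => ?_
    rw [Nat.cofinite_eq_atTop]
    filter_upwards [eventually_ge_atTop m] with k hk x
    rw [iteratedFDeriv_comp_sub]
    exact hgb k m hk _
  · refine HasCompactSupport.intro (isCompact_closedBall (0 : ℝ × V) 2) fun x hx => ?_
    have hx' : 2 < ‖x‖ := by simpa using hx
    have hz : ∀ k, g k (x - p k) = 0 := fun k => hg0 k _ (by
      linarith [norm_sub_norm_le x (p k), hp k, hle1 k])
    simp [hz]
  · have hball : ∀ᶠ x : ℝ × V in 𝓝 0, ‖x‖ < (1 / 2) ^ k / 4 := by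
      filter_upwards [Metric.ball_mem_nhds (0 : ℝ × V) (by positivity : (0:ℝ) < (1 / 2) ^ k / 4)]
        with x hx
      simpa using hx
    filter_upwards [hball, hgf k] with x hx hxf
    rw [tsum_eq_single k fun l hl => hdisj k l hl _ (by simpa using hx), add_sub_cancel_right, hxf]

theorem backwardCone_subset_closedBall {d : ℕ} (p : ℝ × EuclideanSpace ℝ (Fin d)) (ε : ℝ) :
    backwardCone p ε ⊆ Metric.closedBall p ε := by
  rintro x ⟨h1, h2, h3⟩
  rw [mem_closedBall_iff_norm, Prod.norm_def]
  refine max_le ?_ ?_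
  · rw [Prod.fst_sub, Real.norm_eq_abs, abs_le]
    constructor <;> linarith
  · rw [Prod.snd_sub]
    linarith

/-- A causal, bounded, translation-equivariant functional `T` on smooth scalar
fields, admitting a Gateaux variation `DT`, depends at each point only on
finitely many derivatives of the field. -/
theorem stmt_0 (d : ℕ)
    (T : ((ℝ × EuclideanSpace ℝ (Fin d)) → ℝ) → ((ℝ × EuclideanSpace ℝ (Fin d)) → ℝ))
    (DT : ((ℝ × EuclideanSpace ℝ (Fin d)) → ℝ) → ((ℝ × EuclideanSpace ℝ (Fin d)) → ℝ) →
      ((ℝ × EuclideanSpace ℝ (Fin d)) → ℝ))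
    -- T sends smooth functions to smooth functions
    (hTsmooth : ∀ Ψ, ContDiff ℝ (⊤ : ℕ∞) Ψ → ContDiff ℝ (⊤ : ℕ∞) (T Ψ))
    -- (C) Causality
    (hC : ∀ Ψ Ψ', ContDiff ℝ (⊤ : ℕ∞) Ψ → ContDiff ℝ (⊤ : ℕ∞) Ψ' →
      ∀ p : ℝ × EuclideanSpace ℝ (Fin d),
      (∃ ε > (0 : ℝ), Set.EqOn Ψ Ψ' (backwardCone p ε)) → T Ψ p = T Ψ' p)
    -- (G) Differentiability along segments: `DT Ψ` is linear, maps smooth to smooth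
    (hDlin : ∀ Ψ, ContDiff ℝ (⊤ : ℕ∞) Ψ → IsLinearMap ℝ (DT Ψ))
    (hDsmooth : ∀ Ψ Φ, ContDiff ℝ (⊤ : ℕ∞) Ψ → ContDiff ℝ (⊤ : ℕ∞) Φ → ContDiff ℝ (⊤ : ℕ∞) (DT Ψ Φ))
    -- s ↦ T[(1−s)Ψ + sΨ'](p) is differentiable on [0,1] with continuous derivative
    (hG : ∀ Ψ Ψ', ContDiff ℝ (⊤ : ℕ∞) Ψ → ContDiff ℝ (⊤ : ℕ∞) Ψ' →
      ∀ p : ℝ × EuclideanSpace ℝ (Fin d),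
      (∀ s ∈ Set.Icc (0 : ℝ) 1,
        HasDerivWithinAt (fun t : ℝ => T ((1 - t) • Ψ + t • Ψ') p)
          (DT ((1 - s) • Ψ + s • Ψ') (Ψ' - Ψ) p) (Set.Icc (0 : ℝ) 1) s) ∧
      ContinuousOn (fun s : ℝ => DT ((1 - s) • Ψ + s • Ψ') (Ψ' - Ψ) p)
        (Set.Icc (0 : ℝ) 1))
    -- DT is the Gateaux variation of T
    (hGateaux : ∀ Ψ Φ, ContDiff ℝ (⊤ : ℕ∞) Ψ → ContDiff ℝ (⊤ : ℕ∞) Φ →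
      ∀ p : ℝ × EuclideanSpace ℝ (Fin d),
      Tendsto (fun h : ℝ => (T (Ψ + h • Φ) p - T Ψ p) / h) (𝓝[≠] 0) (𝓝 (DT Ψ Φ p)))
    -- (B) Boundedness
    (hB : ∀ Φ, ContDiff ℝ (⊤ : ℕ∞) Φ → HasCompactSupport Φ →
      ∀ K : Set (ℝ × EuclideanSpace ℝ (Fin d)), IsCompact K →
      ∃ C : ℝ, ∀ Ψ, ContDiff ℝ (⊤ : ℕ∞) Ψ → ∀ p ∈ K, |DT Ψ Φ p| ≤ C)
    -- (T) Translation equivariance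
    (hT : ∀ a : ℝ × EuclideanSpace ℝ (Fin d), ∀ Ψ, ContDiff ℝ (⊤ : ℕ∞) Ψ →
      T (Ψ ∘ fun x => x + a) = (T Ψ) ∘ fun x => x + a) :
    ∃ M : ℕ, ∀ p : ℝ × EuclideanSpace ℝ (Fin d), ∀ Ψ Ψ',
      ContDiff ℝ (⊤ : ℕ∞) Ψ → ContDiff ℝ (⊤ : ℕ∞) Ψ' →
      (∀ j ≤ M, iteratedFDeriv ℝ j Ψ p = iteratedFDeriv ℝ j Ψ' p) →
      T Ψ p = T Ψ' p := by
  have hloc : ∀ Ψ Φ Φ', ContDiff ℝ (⊤ : ℕ∞) Ψ → ContDiff ℝ (⊤ : ℕ∞) Φ →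
      ContDiff ℝ (⊤ : ℕ∞) Φ' → ∀ p, Φ =ᶠ[𝓝 p] Φ' → DT Ψ Φ p = DT Ψ Φ' p := by
    intro Ψ Φ Φ' hΨ hΦ hΦ' p heq
    obtain ⟨ε, hε, hsub⟩ := Metric.nhds_basis_closedBall.mem_iff.1 heq
    refine tendsto_nhds_unique (hGateaux Ψ Φ hΨ hΦ p)
      ((hGateaux Ψ Φ' hΨ hΦ' p).congr fun h => ?_)
    rw [hC (Ψ + h • Φ) (Ψ + h • Φ') (hΨ.add (hΦ.const_smul h)) (hΨ.add (hΦ'.const_smul h)) p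
      ⟨ε, hε, fun x hx => ?_⟩]
    have : Φ x = Φ' x := hsub (backwardCone_subset_closedBall p ε hx)
    simp [this]
  have hshift : ∀ (a : ℝ × EuclideanSpace ℝ (Fin d))
      (Ψ : ℝ × EuclideanSpace ℝ (Fin d) → ℝ), ContDiff ℝ (⊤ : ℕ∞) Ψ →
      ContDiff ℝ (⊤ : ℕ∞) (Ψ ∘ fun x => x + a) := fun a Ψ hΨ =>
    hΨ.comp (contDiff_id.add contDiff_const)
  have hDT : ∀ a Ψ Φ, ContDiff ℝ (⊤ : ℕ∞) Ψ → ContDiff ℝ (⊤ : ℕ∞) Φ → ∀ p,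
      DT (Ψ ∘ fun x => x + a) (Φ ∘ fun x => x + a) p = DT Ψ Φ (p + a) := by
    intro a Ψ Φ hΨ hΦ p
    refine tendsto_nhds_unique (hGateaux _ _ (hshift a Ψ hΨ) (hshift a Φ hΦ) p)
      ((hGateaux Ψ Φ hΨ hΦ (p + a)).congr fun h => ?_)
    have hcomp : (Ψ ∘ fun x => x + a) + h • (Φ ∘ fun x => x + a) =
        (Ψ + h • Φ) ∘ fun x => x + a := rfl
    rw [hcomp, hT a (Ψ + h • Φ) (hΨ.add (hΦ.const_smul h)), hT a _ hΨ]
    rfl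
  obtain ⟨M, hM⟩ : ∃ M : ℕ, ∀ Ψ Φ : ℝ × EuclideanSpace ℝ (Fin d) → ℝ, ContDiff ℝ (⊤ : ℕ∞) Ψ → ContDiff ℝ (⊤ : ℕ∞) Φ →
      (∀ j ≤ M, iteratedFDeriv ℝ j Φ 0 = 0) → DT Ψ Φ 0 = 0 := by
    by_contra! hcon
    choose Ψ Φ hΨ hΦ hjet hne using hcon
    have hf : ∀ k : ℕ, ContDiff ℝ (⊤ : ℕ∞) (((k : ℝ) / DT (Ψ k) (Φ k) 0) • Φ k) :=
      fun k => contDiff_const.smul (hΦ k)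
    obtain ⟨Θ, p, hΘ, hΘc, hp, hgerm⟩ := exists_testFunction_of_jets_eq_zero
      (fun k => ((k : ℝ) / DT (Ψ k) (Φ k) 0) • Φ k) hf fun k j hj => by
        rw [iteratedFDeriv_const_smul_apply ((hΦ k).of_le (by exact_mod_cast le_top)).contDiffAt,
          hjet k j hj, smul_zero]
    obtain ⟨C, hCb⟩ := hB Θ hΘ hΘc _ (isCompact_closedBall 0 1)
    obtain ⟨k, hk⟩ := exists_nat_gt C
    have hback : ((Ψ k ∘ fun x => x + -p k) ∘ fun x => x + p k) = Ψ k := by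
      ext x
      simp
    have hval : DT (Ψ k ∘ fun x => x + -p k) Θ (p k) = k := by
      have h1 := hDT (p k) _ Θ (hshift (-p k) (Ψ k) (hΨ k)) hΘ 0
      rw [hback, zero_add] at h1
      rw [← h1, hloc _ _ _ (hΨ k) (hshift _ _ hΘ) (hf k) 0 (hgerm k),
        (hDlin _ (hΨ k)).map_smul, Pi.smul_apply, smul_eq_mul, div_mul_cancel₀ _ (hne k)]
    have hle := hCb _ (hshift (-p k) (Ψ k) (hΨ k)) (p k) (by simpa using hp k)
    rw [hval, Nat.abs_cast] at hle
    linarith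
  refine ⟨M, fun p Ψ Ψ' hΨ hΨ' hjet => ?_⟩
  have hΔ : ContDiff ℝ (⊤ : ℕ∞) (Ψ' - Ψ) := hΨ'.sub hΨ
  have hzero : ∀ s : ℝ, DT ((1 - s) • Ψ + s • Ψ') (Ψ' - Ψ) p = 0 := by
    intro s
    have hs : ContDiff ℝ (⊤ : ℕ∞) ((1 - s) • Ψ + s • Ψ') :=
      (contDiff_const.smul hΨ).add (contDiff_const.smul hΨ')
    have h1 := hDT p _ _ hs hΔ 0
    rw [zero_add] at h1
    rw [← h1]
    refine hM _ _ (hshift p _ hs) (hshift p _ hΔ) fun j hj => ?_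
    have hsub := iteratedFDeriv_sub_apply (x := p) (i := j)
      (hΨ'.of_le (by exact_mod_cast le_top)).contDiffAt
      (hΨ.of_le (by exact_mod_cast le_top)).contDiffAt
    rw [Function.comp_def, iteratedFDeriv_comp_add_right, zero_add, hsub, hjet j hj, sub_self]
  have hderiv := (hG Ψ Ψ' hΨ hΨ' p).1
  have hconst := constant_of_derivWithin_zero
    (fun s hs => (hderiv s hs).differentiableWithinAt)
    (fun s hs => by
      have hs' := Set.Ico_subset_Icc_self hs
      rw [(hderiv s hs').derivWithin (uniqueDiffOn_Icc_zero_one s hs'), hzero])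
    1 (Set.right_mem_Icc.2 zero_le_one)
  simpa using hconst.symm
end

section
/- Let 𝔏 be a set of linear maps, each sending smooth functions ℝⁿ → ℝ to smooth functions ℝⁿ → ℝ, such that: (i) every L ∈ 𝔏 is support-non-increasing, i.e. tsupport(LΦ) ⊆ tsupport(Φ) for every smooth Φ; (ii) for every compactly supported smooth Φ and every compact K ⊆ ℝⁿ, sup over L ∈ 𝔏 and x ∈ K of |LΦ(x)| is finite. Then for every point p ∈ ℝⁿ there exist a natural number M and a radius r > 0 such that each L ∈ 𝔏 acts as a differential operator of order at most M on the open ball B_r(p): for each L ∈ 𝔏 there exist smooth coefficient functions c_{L,α} : B_r(p) → ℝ, indexed by multi-indices α with |α| ≤ M, such that for every smooth Φ : ℝⁿ → ℝ and every x ∈ B_r(p), LΦ(x) = Σ_{|α| ≤ M} c_{L,α}(x) ∂^α Φ(x). -/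
open Filter Topology Metric

/-- Partial derivative of a scalar field in the `i`-th coordinate direction. -/
noncomputable def pderivE {n : ℕ} (i : Fin n)
    (f : EuclideanSpace ℝ (Fin n) → ℝ) : EuclideanSpace ℝ (Fin n) → ℝ :=
  fun x => fderiv ℝ f x (EuclideanSpace.single i 1)

/-- Iterated partial derivative `∂^α` associated to a multi-index
`α = (α₁, …, αₙ)`, applying `αᵢ` derivatives in the `i`-th direction. -/
noncomputable def pderivMulti {n : ℕ} (α : Fin n → ℕ) :
    (EuclideanSpace ℝ (Fin n) → ℝ) → (EuclideanSpace ℝ (Fin n) → ℝ) :=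
  (List.ofFn fun i : Fin n => (pderivE i)^[α i]).foldr (· ∘ ·) id

theorem norm_iteratedFDeriv_le_mul_pow {E F : Type*} [NormedAddCommGroup E] [NormedSpace ℝ E]
    [NormedAddCommGroup F] [NormedSpace ℝ F] {f : E → F} (hf : ContDiff ℝ (⊤ : ℕ∞) f) {a : E} {k : ℕ}
    (h : ∀ j ≤ k, iteratedFDeriv ℝ j f a = 0) {C R : ℝ}
    (hC : ∀ x ∈ closedBall a R, ‖iteratedFDeriv ℝ (k + 1) f x‖ ≤ C) {i j : ℕ} (hij : j + i = k + 1) :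
    ∀ x ∈ closedBall a R, ‖iteratedFDeriv ℝ j f x‖ ≤ C * ‖x - a‖ ^ i := by
  induction i generalizing j with
  | zero => intro x hx; obtain rfl : j = k + 1 := hij; simpa using hC x hx
  | succ i ih =>
    intro x hx
    have hd : Differentiable ℝ (iteratedFDeriv ℝ j f) :=
      hf.differentiable_iteratedFDeriv (by exact_mod_cast ENat.natCast_lt_top j)
    have hx' : ‖x - a‖ ≤ R := by simpa [dist_eq_norm] using hx
    have hC0 : 0 ≤ C := (norm_nonneg _).trans (hC x hx)
    have key := (convex_closedBall a ‖x - a‖).norm_image_sub_le_of_norm_fderiv_le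
      (f := iteratedFDeriv ℝ j f) (C := C * ‖x - a‖ ^ i) (x := a) (y := x) (𝕜 := ℝ)
      (fun y _ => hd y) (fun y hy => by
        rw [norm_fderiv_iteratedFDeriv]
        have hy' : ‖y - a‖ ≤ ‖x - a‖ := by simpa [dist_eq_norm] using hy
        refine (ih (by omega) y (by simpa [dist_eq_norm] using hy'.trans hx')).trans ?_
        gcongr)
      (by simp) (by simp [dist_eq_norm])
    rw [h j (by omega), sub_zero] at key
    rwa [pow_succ, ← mul_assoc]

theorem exists_smooth_eventuallyEq_small {E : Type*} [NormedAddCommGroup E]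
    [NormedSpace ℝ E] [FiniteDimensional ℝ E] {f : E → ℝ} (hf : ContDiff ℝ (⊤ : ℕ∞) f) {a : E} {k : ℕ}
    (h : ∀ j ≤ k, iteratedFDeriv ℝ j f a = 0) {δ η : ℝ} (hδ : 0 < δ) (hη : 0 < η) :
    ∃ g : E → ℝ, ContDiff ℝ (⊤ : ℕ∞) g ∧ g =ᶠ[𝓝 a] f ∧ Function.support g ⊆ closedBall a δ ∧
      ∀ j ≤ k, ∀ x, ‖iteratedFDeriv ℝ j g x‖ ≤ η := by
  let χ : ContDiffBump (0 : E) := ⟨1, 2, one_pos, one_lt_two⟩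
  have hχ : ContDiff ℝ (⊤ : ℕ∞) χ := χ.contDiff
  have hB : ∀ i : ℕ, ∃ B, ∀ x, ‖iteratedFDeriv ℝ i χ x‖ ≤ B := fun i =>
    (hχ.continuous_iteratedFDeriv (by exact_mod_cast le_top)).bounded_above_of_compact_support
      (χ.hasCompactSupport.iteratedFDeriv i)
  choose B hB using hB
  have hB0 : ∀ i, 0 ≤ B i := fun i => (norm_nonneg _).trans (hB i 0)
  obtain ⟨C, hC⟩ := (isCompact_closedBall a (1 : ℝ)).exists_bound_of_continuousOn
    (hf.continuous_iteratedFDeriv (m := k + 1) (by exact_mod_cast le_top)).continuousOn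
  have hC0 : 0 ≤ C := (norm_nonneg _).trans (hC a (by simp))
  set T : ℕ → ℝ := fun j => ∑ i ∈ Finset.range (j + 1), (j.choose i : ℝ) * B i * C * 2 ^ (k + 1) with hT
  have hT0 : ∀ j, 0 ≤ T j := fun j => Finset.sum_nonneg fun i _ => by have := hB0 i; positivity
  set S : ℝ := ∑ j ∈ Finset.range (k + 1), T j
  have hS0 : 0 ≤ S := Finset.sum_nonneg fun j _ => hT0 j
  obtain ⟨ε, hε, hε1, hεδ, hεη⟩ : ∃ ε : ℝ, 0 < ε ∧ 2 * ε ≤ 1 ∧ 2 * ε ≤ δ ∧ ε * S ≤ η := by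
    refine ⟨min (1 / 2) (min (δ / 2) (η / (S + 1))), by positivity, ?_, ?_, ?_⟩
    · linarith [min_le_left (1 / 2) (min (δ / 2) (η / (S + 1)))]
    · linarith [(min_le_right (1 / 2) (min (δ / 2) (η / (S + 1)))).trans (min_le_left _ _)]
    · have h1 := (min_le_right (1 / 2) (min (δ / 2) (η / (S + 1)))).trans (min_le_right _ _)
      rw [le_div_iff₀ (by positivity)] at h1
      refine le_trans ?_ h1
      gcongr
      linarith
  set ψ : E → ℝ := fun y => χ (ε⁻¹ • (y - a)) with hψ
  have hψs : ContDiff ℝ (⊤ : ℕ∞) ψ := hχ.comp (by fun_prop)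
  have hzero : ∀ x, x ∉ closedBall a (2 * ε) → ψ x = 0 := fun x hx => by
    apply χ.zero_of_le_dist
    simp only [mem_closedBall, dist_eq_norm, not_le] at hx
    rw [dist_zero_right, norm_smul, norm_inv, Real.norm_of_nonneg hε.le, inv_mul_eq_div,
      le_div_iff₀ hε]
    exact hx.le
  refine ⟨fun x => ψ x * f x, hψs.mul hf, ?_, ?_, ?_⟩
  · filter_upwards [closedBall_mem_nhds a hε] with x hx
    have : ψ x = 1 := by
      apply χ.one_of_mem_closedBall
      rw [mem_closedBall, dist_zero_right, norm_smul, norm_inv, Real.norm_of_nonneg hε.le,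
        inv_mul_eq_div, div_le_iff₀ hε]
      simpa [dist_eq_norm, χ] using hx
    simp [this]
  · intro x hx
    by_contra hx'
    exact hx (by simp [hzero x (fun h => hx' (closedBall_subset_closedBall hεδ h))])
  · intro j hj x
    by_cases hx : x ∈ closedBall a (2 * ε)
    · refine le_trans ?_ hεη
      have hle : T j ≤ S := Finset.single_le_sum (f := T) (fun j _ => hT0 j) (by simp; omega)
      refine le_trans ?_ (mul_le_mul_of_nonneg_left hle hε.le)
      refine (norm_iteratedFDeriv_mul_le hψs hf x (n := j) (by exact_mod_cast le_top)).trans ?_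
      rw [hT, Finset.mul_sum]
      refine Finset.sum_le_sum fun i hi => ?_
      have hi : i ≤ j := by simp at hi; omega
      have h1 : ‖iteratedFDeriv ℝ i ψ x‖ ≤ (ε⁻¹) ^ i * B i := by
        rw [hψ, iteratedFDeriv_comp_sub (f := fun y => χ (ε⁻¹ • y)) i a x,
          iteratedFDeriv_comp_const_smul _ (hχ.of_le (by exact_mod_cast le_top)), norm_smul, norm_pow,
          norm_inv, Real.norm_of_nonneg hε.le]
        gcongr
        exact hB _ _
      have h2 : ‖iteratedFDeriv ℝ (j - i) f x‖ ≤ C * (2 * ε) ^ (k + 1 - j + i) := by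
        refine (norm_iteratedFDeriv_le_mul_pow hf h hC (i := k + 1 - j + i) (by omega) x
          (closedBall_subset_closedBall hε1 hx)).trans ?_
        gcongr
        simpa [dist_eq_norm] using hx
      have h3 : ε⁻¹ ^ i * (2 * ε) ^ (k + 1 - j + i) ≤ ε * 2 ^ (k + 1) := by
        have : ε⁻¹ ^ i * (2 * ε) ^ (k + 1 - j + i) = ε ^ (k + 1 - j) * 2 ^ (k + 1 - j + i) := by
          rw [mul_pow, pow_add ε, inv_pow]; field_simp
        rw [this]
        exact mul_le_mul (pow_le_of_le_one hε.le (by linarith) (by omega))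
          (pow_le_pow_right₀ one_le_two (by omega)) (by positivity) hε.le
      calc _ ≤ (j.choose i : ℝ) * ((ε⁻¹) ^ i * B i) * (C * (2 * ε) ^ (k + 1 - j + i)) := by
            have := hB0 i
            gcongr
        _ = (j.choose i : ℝ) * B i * C * (ε⁻¹ ^ i * (2 * ε) ^ (k + 1 - j + i)) := by ring
        _ ≤ (j.choose i : ℝ) * B i * C * (ε * 2 ^ (k + 1)) := by
            have := hB0 i
            gcongr
        _ = _ := by ring
    · have : (fun x => ψ x * f x) =ᶠ[𝓝 x] fun _ => 0 := by
        filter_upwards [isClosed_closedBall.isOpen_compl.mem_nhds hx] with y hy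
        simp [hzero y hy]
      rw [(this.iteratedFDeriv ℝ j).eq_of_nhds]
      simpa using hη.le

theorem LocalOperator.apply_eq_of_eventuallyEq {E : Type*} [NormedAddCommGroup E] [NormedSpace ℝ E]
    {L : (E → ℝ) → (E → ℝ)} (hlin : IsLinearMap ℝ L)
    (hsupp : ∀ Φ, ContDiff ℝ (⊤ : ℕ∞) Φ → tsupport (L Φ) ⊆ tsupport Φ) {f g : E → ℝ}
    (hf : ContDiff ℝ (⊤ : ℕ∞) f) (hg : ContDiff ℝ (⊤ : ℕ∞) g) {x : E} (h : f =ᶠ[𝓝 x] g) :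
    L f x = L g x := by
  have hx : x ∉ tsupport (f - g) := by
    rw [notMem_tsupport_iff_eventuallyEq]
    filter_upwards [h] with y hy
    simp [hy]
  have := image_eq_zero_of_notMem_tsupport fun h' => hx (hsupp _ (hf.sub hg) h')
  change L (f - g) x = 0 at this
  rw [hlin.map_sub] at this
  exact sub_eq_zero.1 this

theorem exists_order_of_locally_bounded_family {E : Type*} [NormedAddCommGroup E] [NormedSpace ℝ E]
    [FiniteDimensional ℝ E] (𝔏 : Set ((E → ℝ) → (E → ℝ)))
    (hlin : ∀ L ∈ 𝔏, IsLinearMap ℝ L)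
    (hsupp : ∀ L ∈ 𝔏, ∀ Φ, ContDiff ℝ (⊤ : ℕ∞) Φ → tsupport (L Φ) ⊆ tsupport Φ)
    (hbdd : ∀ Φ, ContDiff ℝ (⊤ : ℕ∞) Φ → HasCompactSupport Φ →
      ∀ K : Set E, IsCompact K → ∃ C : ℝ, ∀ L ∈ 𝔏, ∀ x ∈ K, |L Φ x| ≤ C) (p : E) :
    ∃ (M : ℕ) (r : ℝ), 0 < r ∧ ∀ L ∈ 𝔏, ∀ x ∈ ball p r, x ≠ p → ∀ Φ, ContDiff ℝ (⊤ : ℕ∞) Φ →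
      (∀ j ≤ M, iteratedFDeriv ℝ j Φ x = 0) → L Φ x = 0 := by
  by_contra! H
  choose! L hL x hx hxp Φ hΦ hj hne using H
  let ρ : ℕ → ℝ := fun k => Nat.rec 1 (fun k r => dist (x k r) p / 4) k
  have hρ : ∀ k, 0 < ρ k := by
    intro k
    induction k with
    | zero => exact one_pos
    | succ k ih => exact div_pos (dist_pos.2 (hxp k (ρ k) ih)) (by norm_num)
  obtain ⟨X, hX⟩ : ∃ X : ℕ → E, ∀ k, X k = x k (ρ k) := ⟨_, fun _ => rfl⟩
  obtain ⟨d, hd⟩ : ∃ d : ℕ → ℝ, ∀ k, d k = dist (X k) p := ⟨_, fun _ => rfl⟩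
  have hd0 : ∀ k, 0 < d k := fun k => by
    rw [hd, hX]; exact dist_pos.2 (hxp k (ρ k) (hρ k))
  have hdρ : ∀ k, d k < ρ k := fun k => by
    rw [hd, hX]; exact hx k (ρ k) (hρ k)
  have hstep : ∀ k, d (k + 1) < d k / 4 := fun k => by
    have : ρ (k + 1) = d k / 4 := by rw [hd, hX]
    rw [← this]; exact hdρ _
  have hanti : Antitone d := antitone_nat_of_succ_le fun k => by linarith [hstep k, hd0 k]
  have hlt : ∀ i j, i < j → d j < d i / 4 := fun i j hij => (hanti hij).trans_lt (hstep i)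
  have hd1 : ∀ k, d k ≤ 1 := fun k => (hanti (Nat.zero_le k)).trans (hdρ 0).le
  have hΨ : ∀ k : ℕ, ∃ g : E → ℝ, ContDiff ℝ (⊤ : ℕ∞) g ∧
      g =ᶠ[𝓝 (X k)] ((k : ℝ) / L k (ρ k) (Φ k (ρ k)) (X k)) • Φ k (ρ k) ∧
      Function.support g ⊆ closedBall (X k) (d k / 4) ∧
      ∀ j ≤ k, ∀ x, ‖iteratedFDeriv ℝ j g x‖ ≤ (1 / 2) ^ k := fun k =>
    exists_smooth_eventuallyEq_small
      (f := ((k : ℝ) / L k (ρ k) (Φ k (ρ k)) (X k)) • Φ k (ρ k)) (contDiff_const.smul (hΦ k _ (hρ k)))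
      (fun j hjk => by
      rw [iteratedFDeriv_const_smul_apply
        ((hΦ k _ (hρ k)).of_le (by exact_mod_cast le_top)).contDiffAt, hX, hj k _ (hρ k) j hjk,
        smul_zero]) (by linarith [hd0 k]) (by positivity)
  choose Ψ hΨs hΨe hΨsupp hΨb using hΨ
  have hball : ∀ k y, y ∈ closedBall (X k) (d k / 4) →
      3 / 4 * d k ≤ dist y p ∧ dist y p ≤ 5 / 4 * d k := by
    intro k y hy
    rw [mem_closedBall] at hy
    have h1 := dist_triangle y (X k) p
    have h2 := dist_triangle_left (X k) p y
    rw [← hd] at h1 h2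
    constructor <;> linarith
  have hdisj : ∀ k l y, y ∈ closedBall (X k) (d k / 4) → l ≠ k → Ψ l y = 0 := by
    intro k l y hy hlk
    by_contra hne
    have h1 := hball k y hy
    have h2 := hball l y (hΨsupp l hne)
    rcases lt_or_gt_of_ne hlk with h | h
    · linarith [hlt _ _ h, hd0 k, hd0 l]
    · linarith [hlt _ _ h, hd0 k, hd0 l]
  have hF : ContDiff ℝ (⊤ : ℕ∞) fun y => ∑' k, Ψ k y := by
    refine contDiff_tsum_of_eventually (v := fun _ k => (1 / 2 : ℝ) ^ k) hΨs
      (fun _ _ => summable_geometric_two) fun m _ => ?_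
    rw [Nat.cofinite_eq_atTop]
    filter_upwards [eventually_ge_atTop m] with k hk y using hΨb k m hk y
  have hFc : HasCompactSupport fun y => ∑' k, Ψ k y := by
    refine HasCompactSupport.intro (isCompact_closedBall p 2) fun y hy => ?_
    have : ∀ k, Ψ k y = 0 := fun k => by
      by_contra hne
      exact hy (by rw [mem_closedBall]; linarith [(hball k y (hΨsupp k hne)).2, hd1 k])
    simp [this]
  obtain ⟨C, hC⟩ := hbdd _ hF hFc _ (isCompact_closedBall p 1)
  obtain ⟨k, hk⟩ := exists_nat_gt C
  have hLk := hL k _ (hρ k)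
  have hval : L k (ρ k) (fun y => ∑' k, Ψ k y) (X k) = k := by
    have hs : ContDiff ℝ (⊤ : ℕ∞) (((k : ℝ) / L k (ρ k) (Φ k (ρ k)) (X k)) • Φ k (ρ k)) :=
      contDiff_const.smul (hΦ k _ (hρ k))
    rw [LocalOperator.apply_eq_of_eventuallyEq (hlin _ hLk) (hsupp _ hLk) hF
      hs (EventuallyEq.trans ?_ (hΨe k)), (hlin _ hLk).map_smul]
    · have := hne k _ (hρ k)
      rw [← hX] at this
      simp [this]
    · filter_upwards [closedBall_mem_nhds (X k) (show 0 < d k / 4 by linarith [hd0 k])] with y hy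
      exact tsum_eq_single k fun l hl => hdisj k l y hy hl
  have := hC _ hLk (X k) (by rw [mem_closedBall, ← hd]; exact hd1 k)
  rw [hval, Nat.abs_cast] at this
  linarith

theorem contDiff_prod_coord {n : ℕ} {F : Fin n → ℝ → ℝ} (hF : ∀ i, ContDiff ℝ (⊤ : ℕ∞) (F i)) :
    ContDiff ℝ (⊤ : ℕ∞) fun y : EuclideanSpace ℝ (Fin n) => ∏ j, F j (y j) :=
  contDiff_prod fun i _ => (hF i).comp (by fun_prop)

theorem pderivE_prod_coord {n : ℕ} {F : Fin n → ℝ → ℝ} (hF : ∀ i, Differentiable ℝ (F i))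
    (i : Fin n) :
    pderivE i (fun y : EuclideanSpace ℝ (Fin n) => ∏ j, F j (y j)) =
      fun y => ∏ j, Function.update F i (deriv (F i)) j (y j) := by
  funext x
  have h : ∀ j, HasFDerivAt (fun y : EuclideanSpace ℝ (Fin n) => F j (y j))
      (deriv (F j) (x j) • (EuclideanSpace.proj j : EuclideanSpace ℝ (Fin n) →L[ℝ] ℝ)) x :=
    fun j => (hF j (x j)).hasDerivAt.comp_hasFDerivAt x
      (EuclideanSpace.proj j : EuclideanSpace ℝ (Fin n) →L[ℝ] ℝ).hasFDerivAt
  rw [pderivE, (HasFDerivAt.finsetProd (u := Finset.univ) fun j _ => h j).fderiv]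
  have hp : ∀ j, (EuclideanSpace.proj j : EuclideanSpace ℝ (Fin n) →L[ℝ] ℝ)
      (EuclideanSpace.single i 1) = if j = i then 1 else 0 := fun j => by simp
  simp only [sum_apply, smul_apply, smul_eq_mul, hp]
  rw [Finset.sum_eq_single i (fun j _ hj => by simp [hj]) (by simp),
    ← Finset.mul_prod_erase _ _ (Finset.mem_univ i)]
  simp only [Function.update_self, if_true, mul_one]
  rw [mul_comm]
  congr 1
  refine Finset.prod_congr rfl fun j hj => ?_
  rw [Function.update_of_ne (Finset.ne_of_mem_erase hj)]

theorem pderivE_iterate_prod_coord {n : ℕ} {F : Fin n → ℝ → ℝ}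
    (hF : ∀ i, ContDiff ℝ (⊤ : ℕ∞) (F i)) (i : Fin n) (m : ℕ) :
    (pderivE i)^[m] (fun y : EuclideanSpace ℝ (Fin n) => ∏ j, F j (y j)) =
      fun y => ∏ j, Function.update F i (deriv^[m] (F i)) j (y j) := by
  induction m with
  | zero => simp
  | succ m ih =>
    rw [Function.iterate_succ_apply', ih, pderivE_prod_coord]
    · simp [Function.iterate_succ_apply']
    · intro j
      rcases eq_or_ne j i with rfl | hj
      · rw [Function.update_self]
        exact ((hF j).iterate_deriv m).differentiable (by simp)
      · rw [Function.update_of_ne hj]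
        exact (hF j).differentiable (by simp)

theorem pderivMulti_eq_foldr_finRange {n : ℕ} (α : Fin n → ℕ) :
    pderivMulti α =
      ((List.finRange n).map fun i : Fin n => (pderivE i)^[α i]).foldr (· ∘ ·) id := by
  rw [pderivMulti, List.ofFn_eq_map]

theorem foldr_pderivE_prod_coord {n : ℕ} {F : Fin n → ℝ → ℝ}
    (hF : ∀ i, ContDiff ℝ (⊤ : ℕ∞) (F i)) (α : Fin n → ℕ) (l : List (Fin n)) (hl : l.Nodup) :
    (l.map fun i : Fin n => (pderivE i)^[α i]).foldr (· ∘ ·) id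
        (fun y : EuclideanSpace ℝ (Fin n) => ∏ j, F j (y j)) =
      fun y => ∏ j, (if j ∈ l then deriv^[α j] (F j) else F j) (y j) := by
  induction l with
  | nil => simp
  | cons i l ih =>
    rw [List.nodup_cons] at hl
    rw [List.map_cons, List.foldr_cons, Function.comp_apply, ih hl.2, pderivE_iterate_prod_coord]
    · funext y
      refine Finset.prod_congr rfl fun j _ => ?_
      rcases eq_or_ne j i with rfl | hj
      · simp [hl.1]
      · simp [hj]
    · intro j
      split_ifs
      · exact (hF j).iterate_deriv _
      · exact hF j

theorem pderivMulti_prod_coord {n : ℕ} {F : Fin n → ℝ → ℝ}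
    (hF : ∀ i, ContDiff ℝ (⊤ : ℕ∞) (F i)) (α : Fin n → ℕ) :
    pderivMulti α (fun y : EuclideanSpace ℝ (Fin n) => ∏ j, F j (y j)) =
      fun y => ∏ j, deriv^[α j] (F j) (y j) := by
  rw [pderivMulti_eq_foldr_finRange, foldr_pderivE_prod_coord hF α _ (List.nodup_finRange n)]
  simp

theorem iterate_deriv_sub_pow (a : ℝ) (m b : ℕ) :
    deriv^[b] (fun t : ℝ => (t - a) ^ m) = fun t => (m.descFactorial b : ℝ) * (t - a) ^ (m - b) := by
  induction b with
  | zero => simp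
  | succ b ih =>
    rw [Function.iterate_succ_apply', ih]
    funext t
    have h : HasDerivAt (fun t : ℝ => (m.descFactorial b : ℝ) * (t - a) ^ (m - b))
        ((m.descFactorial b : ℝ) * (((m - b : ℕ) : ℝ) * (t - a) ^ (m - b - 1) * 1)) t :=
      (((hasDerivAt_id t).sub_const a).pow (m - b)).const_mul _
    rw [h.deriv, Nat.descFactorial_succ, Nat.sub_sub]
    push_cast
    ring

theorem iterate_deriv_sub_pow_self (a : ℝ) (m b : ℕ) :
    deriv^[b] (fun t : ℝ => (t - a) ^ m) a = if b = m then (m.factorial : ℝ) else 0 := by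
  rw [iterate_deriv_sub_pow]
  split_ifs with h
  · subst h; simp [Nat.descFactorial_self]
  · rcases lt_or_gt_of_ne h with h | h
    · simp [Nat.sub_ne_zero_of_lt h]
    · simp [Nat.descFactorial_of_lt h]

/-- The monomial `(y - x)^β`, as a function of `y`. -/
noncomputable def centeredMonomial {n : ℕ} (β : Fin n → ℕ) (x y : EuclideanSpace ℝ (Fin n)) : ℝ :=
  ∏ i, (y i - x i) ^ β i

theorem contDiff_centeredMonomial {n : ℕ} (β : Fin n → ℕ) (x : EuclideanSpace ℝ (Fin n)) :
    ContDiff ℝ (⊤ : ℕ∞) (centeredMonomial β x) :=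
  contDiff_prod_coord (F := fun i t => (t - x i) ^ β i) fun i => by fun_prop

theorem pderivMulti_centeredMonomial_self {n : ℕ} (α β : Fin n → ℕ)
    (x : EuclideanSpace ℝ (Fin n)) :
    pderivMulti α (centeredMonomial β x) x = if α = β then ∏ i, ((β i).factorial : ℝ) else 0 := by
  have := pderivMulti_prod_coord (F := fun i t => (t - x i) ^ β i) (fun i => by fun_prop) α
  unfold centeredMonomial
  rw [this]
  simp only [iterate_deriv_sub_pow_self]
  split_ifs with h
  · subst h; simp
  · obtain ⟨i, hi⟩ := Function.ne_iff.1 h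
    exact Finset.prod_eq_zero (Finset.mem_univ i) (by simp [hi])

theorem centeredMonomial_eq_sum {n : ℕ} (β : Fin n → ℕ) (x : EuclideanSpace ℝ (Fin n)) :
    centeredMonomial β x = ∑ γ ∈ Fintype.piFinset fun i => Finset.range (β i + 1),
      (∏ i, ((-x i) ^ (β i - γ i) * ((β i).choose (γ i) : ℝ))) • centeredMonomial γ 0 := by
  funext y
  rw [centeredMonomial]
  simp only [sub_eq_add_neg, add_pow, Finset.prod_univ_sum, Finset.sum_apply, Pi.smul_apply,
    smul_eq_mul]
  refine Finset.sum_congr rfl fun γ _ => ?_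
  rw [centeredMonomial, ← Finset.prod_mul_distrib]
  refine Finset.prod_congr rfl fun i _ => ?_
  simp
  ring

theorem contDiff_sub_sum_smul {E : Type*} [NormedAddCommGroup E] [NormedSpace ℝ E] {ι : Type*}
    (s : Finset ι) (c : ι → ℝ) {f : E → ℝ} {e : ι → E → ℝ} (hf : ContDiff ℝ (⊤ : ℕ∞) f)
    (he : ∀ i, ContDiff ℝ (⊤ : ℕ∞) (e i)) : ContDiff ℝ (⊤ : ℕ∞) (f - ∑ i ∈ s, c i • e i) := by
  have := hf.sub (ContDiff.sum (s := s) fun i _ => (he i).const_smul (c i))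
  convert this using 1
  funext x
  simp

/-- Operators on scalar fields that preserve smoothness and act linearly on smooth fields. -/
def IsSmoothLinear {E : Type*} [NormedAddCommGroup E] [NormedSpace ℝ E]
    (T : (E → ℝ) → (E → ℝ)) : Prop :=
  (∀ f, ContDiff ℝ (⊤ : ℕ∞) f → ContDiff ℝ (⊤ : ℕ∞) (T f)) ∧
    ∀ f g, ContDiff ℝ (⊤ : ℕ∞) f → ContDiff ℝ (⊤ : ℕ∞) g → ∀ c : ℝ, T (f + c • g) = T f + c • T g

namespace IsSmoothLinear

variable {E : Type*} [NormedAddCommGroup E] [NormedSpace ℝ E] {S T : (E → ℝ) → (E → ℝ)}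

theorem id : IsSmoothLinear (id : (E → ℝ) → (E → ℝ)) :=
  ⟨fun _ h => h, fun _ _ _ _ _ => rfl⟩

theorem comp (hS : IsSmoothLinear S) (hT : IsSmoothLinear T) : IsSmoothLinear (S ∘ T) :=
  ⟨fun f hf => hS.1 _ (hT.1 f hf), fun f g hf hg c => by
    rw [Function.comp_apply, hT.2 f g hf hg, hS.2 _ _ (hT.1 f hf) (hT.1 g hg)]; rfl⟩

theorem iterate (hT : IsSmoothLinear T) (m : ℕ) : IsSmoothLinear T^[m] := by
  induction m with
  | zero => exact .id
  | succ m ih => exact ih.comp hT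

theorem foldr_comp {l : List ((E → ℝ) → (E → ℝ))} (hl : ∀ T ∈ l, IsSmoothLinear T) :
    IsSmoothLinear (l.foldr (· ∘ ·) _root_.id) := by
  induction l with
  | nil => exact .id
  | cons T l ih =>
    exact (hl T (by simp)).comp (ih fun T hT => hl T (by simp [hT]))

theorem map_sub_sum (hT : IsSmoothLinear T) {ι : Type*} (s : Finset ι) (c : ι → ℝ) {f : E → ℝ}
    {e : ι → E → ℝ} (hf : ContDiff ℝ (⊤ : ℕ∞) f) (he : ∀ i, ContDiff ℝ (⊤ : ℕ∞) (e i)) :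
    T (f - ∑ i ∈ s, c i • e i) = T f - ∑ i ∈ s, c i • T (e i) := by
  classical
  induction s using Finset.induction_on with
  | empty => simp
  | insert a s ha ih =>
    have hs := contDiff_sub_sum_smul s c hf he
    have h := hT.2 _ _ hs (he a) (-c a)
    rw [Finset.sum_insert ha, Finset.sum_insert ha]
    calc T (f - (c a • e a + ∑ i ∈ s, c i • e i))
        = T (f - ∑ i ∈ s, c i • e i + (-c a) • e a) := by congr 1; module
      _ = T f - ∑ i ∈ s, c i • T (e i) + (-c a) • T (e a) := by rw [h, ih]
      _ = _ := by module

end IsSmoothLinear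

theorem isSmoothLinear_pderivE {n : ℕ} (i : Fin n) : IsSmoothLinear (pderivE i) := by
  refine ⟨fun f hf => ?_, fun f g hf hg c => ?_⟩
  · exact (hf.fderiv_right (m := (⊤ : ℕ∞)) (by simp)).clm_apply contDiff_const
  · funext x
    have hf' : DifferentiableAt ℝ f x := hf.differentiable (by simp) x
    have hg' : DifferentiableAt ℝ g x := hg.differentiable (by simp) x
    simp [pderivE, fderiv_add hf' (hg'.const_smul c), fderiv_const_smul hg']

theorem isSmoothLinear_foldr_pderivE {n : ℕ} (α : Fin n → ℕ) (l : List (Fin n)) :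
    IsSmoothLinear ((l.map fun i : Fin n => (pderivE i)^[α i]).foldr (· ∘ ·) id) :=
  .foldr_comp fun T hT => by
    obtain ⟨i, -, rfl⟩ := List.mem_map.1 hT
    exact (isSmoothLinear_pderivE i).iterate _

theorem isSmoothLinear_pderivMulti {n : ℕ} (α : Fin n → ℕ) : IsSmoothLinear (pderivMulti α) := by
  rw [pderivMulti_eq_foldr_finRange]
  exact isSmoothLinear_foldr_pderivE α _

theorem pderivE_comm {n : ℕ} (i j : Fin n) {f : EuclideanSpace ℝ (Fin n) → ℝ}
    (hf : ContDiff ℝ (⊤ : ℕ∞) f) : pderivE i (pderivE j f) = pderivE j (pderivE i f) := by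
  have hd : Differentiable ℝ (fderiv ℝ f) :=
    (hf.fderiv_right (m := (⊤ : ℕ∞)) (by simp)).differentiable (by simp)
  have key : ∀ (a b : Fin n) x, pderivE a (pderivE b f) x =
      fderiv ℝ (fderiv ℝ f) x (EuclideanSpace.single a 1) (EuclideanSpace.single b 1) := by
    intro a b x
    change fderiv ℝ (fun y => fderiv ℝ f y (EuclideanSpace.single b 1)) x _ = _
    rw [fderiv_clm_apply (hd x) (differentiableAt_const _)]
    simp
  funext x
  rw [key, key]
  exact (hf.contDiffAt.isSymmSndFDerivAt (by
    simpa using WithTop.coe_le_coe.2 (le_top : (2 : ℕ∞) ≤ ⊤))) _ _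

theorem pderivE_iterate_comm {n : ℕ} (i j : Fin n) (m : ℕ) {f : EuclideanSpace ℝ (Fin n) → ℝ}
    (hf : ContDiff ℝ (⊤ : ℕ∞) f) :
    pderivE i ((pderivE j)^[m] f) = (pderivE j)^[m] (pderivE i f) := by
  induction m with
  | zero => rfl
  | succ m ih =>
    rw [Function.iterate_succ_apply', Function.iterate_succ_apply', ← ih,
      pderivE_comm i j (((isSmoothLinear_pderivE j).iterate m).1 f hf)]

theorem pderivE_foldr_pderivE {n : ℕ} (α : Fin n → ℕ) (i : Fin n)
    {f : EuclideanSpace ℝ (Fin n) → ℝ} (hf : ContDiff ℝ (⊤ : ℕ∞) f) (l : List (Fin n))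
    (hl : l.Nodup) (hi : i ∈ l) :
    pderivE i ((l.map fun j : Fin n => (pderivE j)^[α j]).foldr (· ∘ ·) id f) =
      (l.map fun j : Fin n => (pderivE j)^[(α + Pi.single i 1 : Fin n → ℕ) j]).foldr (· ∘ ·) id f := by
  induction l with
  | nil => simp at hi
  | cons a l ih =>
    rw [List.nodup_cons] at hl
    simp only [List.map_cons, List.foldr_cons, Function.comp_apply]
    rcases eq_or_ne a i with rfl | ha
    · have : (l.map fun j : Fin n => (pderivE j)^[(α + Pi.single a 1 : Fin n → ℕ) j]) =
          l.map fun j : Fin n => (pderivE j)^[α j] :=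
        List.map_congr_left fun j hj => by
          have : j ≠ a := fun h => hl.1 (h ▸ hj)
          simp [this]
      rw [this, ← Function.iterate_succ_apply' (pderivE a)]
      simp
    · have hil : i ∈ l := (List.mem_cons.1 hi).resolve_left ha.symm
      rw [pderivE_iterate_comm _ _ _ ((isSmoothLinear_foldr_pderivE α l).1 f hf), ih hl.2 hil]
      simp [ha]

theorem pderivE_pderivMulti {n : ℕ} (α : Fin n → ℕ) (i : Fin n)
    {f : EuclideanSpace ℝ (Fin n) → ℝ} (hf : ContDiff ℝ (⊤ : ℕ∞) f) :
    pderivE i (pderivMulti α f) = pderivMulti (α + Pi.single i 1) f := by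
  rw [pderivMulti_eq_foldr_finRange, pderivMulti_eq_foldr_finRange]
  exact pderivE_foldr_pderivE α i hf _ (List.nodup_finRange n) (List.mem_finRange i)

theorem pderivMulti_zero {n : ℕ} (f : EuclideanSpace ℝ (Fin n) → ℝ) : pderivMulti 0 f = f := by
  rw [pderivMulti_eq_foldr_finRange]
  induction List.finRange n with
  | nil => rfl
  | cons a l ih => simpa using ih

theorem exists_iteratedFDeriv_single_eq_pderivMulti {n : ℕ} {f : EuclideanSpace ℝ (Fin n) → ℝ}
    (hf : ContDiff ℝ (⊤ : ℕ∞) f) (j : ℕ) (v : Fin j → Fin n) :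
    ∃ α : Fin n → ℕ, ∑ i, α i = j ∧ ∀ x,
      iteratedFDeriv ℝ j f x (fun k => EuclideanSpace.single (v k) 1) = pderivMulti α f x := by
  induction j with
  | zero => exact ⟨0, by simp, fun x => by simp [pderivMulti_zero]⟩
  | succ j ih =>
    obtain ⟨α, hα, h⟩ := ih (Fin.tail v)
    refine ⟨α + Pi.single (v 0) 1, by simp [Finset.sum_add_distrib, hα], fun x => ?_⟩
    have hd : DifferentiableAt ℝ (iteratedFDeriv ℝ j f) x :=
      hf.differentiable_iteratedFDeriv (by exact_mod_cast ENat.natCast_lt_top j) x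
    rw [hd.iteratedFDeriv_succ_apply_left', ← pderivE_pderivMulti α (v 0) hf, ← funext h]
    rfl

theorem iteratedFDeriv_eq_zero_of_pderivMulti {n : ℕ} {f : EuclideanSpace ℝ (Fin n) → ℝ}
    (hf : ContDiff ℝ (⊤ : ℕ∞) f) {x : EuclideanSpace ℝ (Fin n)} {j : ℕ}
    (h : ∀ α : Fin n → ℕ, ∑ i, α i = j → pderivMulti α f x = 0) : iteratedFDeriv ℝ j f x = 0 := by
  apply ContinuousMultilinearMap.toMultilinearMap_injective
  refine Module.Basis.ext_multilinear
    (fun _ => (EuclideanSpace.basisFun (Fin n) ℝ).toBasis) fun v => ?_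
  obtain ⟨α, hα, hv⟩ := exists_iteratedFDeriv_single_eq_pderivMulti hf j v
  simpa [hv] using h α hα

theorem iteratedFDeriv_sub_taylor_eq_zero {n : ℕ} {f : EuclideanSpace ℝ (Fin n) → ℝ}
    (hf : ContDiff ℝ (⊤ : ℕ∞) f) (x : EuclideanSpace ℝ (Fin n)) {M j : ℕ} (hj : j ≤ M) :
    iteratedFDeriv ℝ j (f - ∑ α : Fin n → Fin (M + 1) with ∑ i, (α i : ℕ) ≤ M,
      (pderivMulti (fun i => (α i : ℕ)) f x / ∏ i, ((α i : ℕ).factorial : ℝ)) •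
        centeredMonomial (fun i => (α i : ℕ)) x) x = 0 := by
  have he := fun α : Fin n → Fin (M + 1) => contDiff_centeredMonomial (fun i => (α i : ℕ)) x
  refine iteratedFDeriv_eq_zero_of_pderivMulti (contDiff_sub_sum_smul _ _ hf he) fun β hβ => ?_
  have hβM : ∀ i, β i < M + 1 := fun i => Nat.lt_succ_of_le <|
    (Finset.single_le_sum (f := β) (fun _ _ => Nat.zero_le _) (Finset.mem_univ i)).trans (hβ.le.trans hj)
  rw [(isSmoothLinear_pderivMulti β).map_sub_sum _ _ hf he]
  simp only [Pi.sub_apply, Finset.sum_apply, Pi.smul_apply, smul_eq_mul,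
    pderivMulti_centeredMonomial_self]
  rw [Finset.sum_eq_single (fun i => ⟨β i, hβM i⟩)]
  · have : ∏ i, ((β i).factorial : ℝ) ≠ 0 :=
      Finset.prod_ne_zero_iff.2 fun i _ => by exact_mod_cast (β i).factorial_ne_zero
    simp [this]
  · intro α _ hα
    rw [if_neg, mul_zero]
    rintro rfl
    exact hα rfl
  · intro h
    exact absurd (by simpa using hβ.le.trans hj) h

/-- The coefficient of `∂^β` in a differential operator `L`. -/
noncomputable def operatorCoeff {n : ℕ}
    (L : (EuclideanSpace ℝ (Fin n) → ℝ) → (EuclideanSpace ℝ (Fin n) → ℝ)) (β : Fin n → ℕ)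
    (x : EuclideanSpace ℝ (Fin n)) : ℝ :=
  L (centeredMonomial β x) x / ∏ i, ((β i).factorial : ℝ)

theorem contDiff_operatorCoeff {n : ℕ}
    {L : (EuclideanSpace ℝ (Fin n) → ℝ) → (EuclideanSpace ℝ (Fin n) → ℝ)} (hL : IsLinearMap ℝ L)
    (hsmooth : ∀ Φ, ContDiff ℝ (⊤ : ℕ∞) Φ → ContDiff ℝ (⊤ : ℕ∞) (L Φ)) (β : Fin n → ℕ) :
    ContDiff ℝ (⊤ : ℕ∞) (operatorCoeff L β) := by
  have h : operatorCoeff L β = fun x =>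
      (∑ γ ∈ Fintype.piFinset fun i => Finset.range (β i + 1),
        (∏ i, ((-x i) ^ (β i - γ i) * ((β i).choose (γ i) : ℝ))) * L (centeredMonomial γ 0) x) /
          ∏ i, ((β i).factorial : ℝ) := by
    funext x
    have := map_sum hL.mk' (fun γ => (∏ i, ((-x i) ^ (β i - γ i) * ((β i).choose (γ i) : ℝ))) •
      centeredMonomial γ 0) (Fintype.piFinset fun i => Finset.range (β i + 1))
    simp only [map_smul, IsLinearMap.mk'_apply] at this
    rw [operatorCoeff, centeredMonomial_eq_sum, this]
    simp
  rw [h]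
  refine ContDiff.div_const (ContDiff.sum fun γ _ => ContDiff.mul ?_
    (hsmooth _ (contDiff_centeredMonomial γ 0))) _
  exact contDiff_prod fun i _ => by fun_prop

theorem apply_eq_sum_operatorCoeff {n : ℕ}
    {L : (EuclideanSpace ℝ (Fin n) → ℝ) → (EuclideanSpace ℝ (Fin n) → ℝ)} (hL : IsLinearMap ℝ L)
    {x : EuclideanSpace ℝ (Fin n)} {M : ℕ}
    (h : ∀ Φ, ContDiff ℝ (⊤ : ℕ∞) Φ → (∀ j ≤ M, iteratedFDeriv ℝ j Φ x = 0) → L Φ x = 0)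
    {Φ : EuclideanSpace ℝ (Fin n) → ℝ} (hΦ : ContDiff ℝ (⊤ : ℕ∞) Φ) :
    L Φ x = ∑ α : Fin n → Fin (M + 1) with ∑ i, (α i : ℕ) ≤ M,
      operatorCoeff L (fun i => (α i : ℕ)) x * pderivMulti (fun i => (α i : ℕ)) Φ x := by
  have h0 := h _ (contDiff_sub_sum_smul _ _ hΦ fun α : Fin n → Fin (M + 1) =>
    contDiff_centeredMonomial (fun i => (α i : ℕ)) x)
    fun j hj => iteratedFDeriv_sub_taylor_eq_zero hΦ x hj
  rw [← hL.mk'_apply, map_sub, map_sum] at h0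
  simp only [map_smul, IsLinearMap.mk'_apply, Pi.sub_apply, Finset.sum_apply, Pi.smul_apply,
    smul_eq_mul] at h0
  rw [sub_eq_zero.1 h0]
  refine Finset.sum_congr rfl fun α _ => ?_
  rw [operatorCoeff]
  ring

/-- A family of support-non-increasing linear operators satisfying a uniform
boundedness condition acts, near each point, as differential operators of a
uniform finite order `M` with smooth coefficients (uniform Peetre theorem). -/
theorem stmt_1 (n : ℕ)
    (𝔏 : Set ((EuclideanSpace ℝ (Fin n) → ℝ) → (EuclideanSpace ℝ (Fin n) → ℝ)))
    (hlin : ∀ L ∈ 𝔏, IsLinearMap ℝ L)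
    (hsmooth : ∀ L ∈ 𝔏, ∀ Φ, ContDiff ℝ (⊤ : ℕ∞) Φ → ContDiff ℝ (⊤ : ℕ∞) (L Φ))
    -- (i) support non-increasing
    (hsupp : ∀ L ∈ 𝔏, ∀ Φ, ContDiff ℝ (⊤ : ℕ∞) Φ → tsupport (L Φ) ⊆ tsupport Φ)
    -- (ii) uniform boundedness
    (hbdd : ∀ Φ, ContDiff ℝ (⊤ : ℕ∞) Φ → HasCompactSupport Φ →
      ∀ K : Set (EuclideanSpace ℝ (Fin n)), IsCompact K →
      ∃ C : ℝ, ∀ L ∈ 𝔏, ∀ x ∈ K, |L Φ x| ≤ C) :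
    ∀ p : EuclideanSpace ℝ (Fin n), ∃ (M : ℕ) (r : ℝ), 0 < r ∧
      ∀ L ∈ 𝔏, ∃ c : (Fin n → ℕ) → EuclideanSpace ℝ (Fin n) → ℝ,
        (∀ α : Fin n → ℕ, (∑ i, α i) ≤ M → ContDiffOn ℝ (⊤ : ℕ∞) (c α) (ball p r)) ∧
        ∀ Φ, ContDiff ℝ (⊤ : ℕ∞) Φ → ∀ x ∈ ball p r,
          L Φ x = ∑ α ∈ Finset.univ.filter
              (fun α : Fin n → Fin (M + 1) => (∑ i, (α i : ℕ)) ≤ M),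
            c (fun i => (α i : ℕ)) x * pderivMulti (fun i => (α i : ℕ)) Φ x := by
  intro p
  obtain ⟨M, r, hr, H⟩ := exists_order_of_locally_bounded_family 𝔏 hlin hsupp hbdd p
  refine ⟨M, r, hr, fun L hL => ⟨operatorCoeff L, fun α _ =>
    (contDiff_operatorCoeff (hlin L hL) (hsmooth L hL) α).contDiffOn, fun Φ hΦ x hx => ?_⟩⟩
  rcases ne_or_eq x p with hxp | rfl
  · exact apply_eq_sum_operatorCoeff (hlin L hL) (H L hL x hx hxp) hΦ
  rcases n.eq_zero_or_pos with rfl | hn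
  · refine apply_eq_sum_operatorCoeff (hlin L hL) (fun Ψ _ hj => ?_) hΦ
    have hx0 : Ψ x = 0 := by
      simpa using congrArg (fun A => A 0) (hj 0 (Nat.zero_le M))
    have : Ψ = 0 := funext fun y => by rw [Subsingleton.elim y x, hx0, Pi.zero_apply]
    rw [this, (hlin L hL).map_zero, Pi.zero_apply]
  · have : Nonempty (Fin n) := ⟨⟨0, hn⟩⟩
    have hc : Continuous fun y => ∑ α : Fin n → Fin (M + 1) with ∑ i, (α i : ℕ) ≤ M,
        operatorCoeff L (fun i => (α i : ℕ)) y * pderivMulti (fun i => (α i : ℕ)) Φ y :=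
      continuous_finsetSum _ fun α _ =>
        (contDiff_operatorCoeff (hlin L hL) (hsmooth L hL) _).continuous.mul
          ((isSmoothLinear_pderivMulti _).1 Φ hΦ).continuous
    refine tendsto_nhds_unique_of_eventuallyEq (l := 𝓝[≠] x)
      ((hsmooth L hL Φ hΦ).continuous.continuousAt.mono_left nhdsWithin_le_nhds)
      (hc.continuousAt.mono_left nhdsWithin_le_nhds) ?_
    filter_upwards [self_mem_nhdsWithin, mem_nhdsWithin_of_mem_nhds (ball_mem_nhds x hr)] with y hy hyr
    exact apply_eq_sum_operatorCoeff (hlin L hL) (H L hL y hyr hy) hΦ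
end
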